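/- For every integer n ≥ 3 and every vertex u ∈ V, the probability of the event E_{8,u} — that there exists a four-cycle rooted at u whose edge sequence pattern (writing s for a local edge and w for a long-range edge) is (w,s,w,w) or (w,w,s,w) — satisfies Pr(E_{8,u}) < (12·ζ(3) + 4) · (ln n + 1) · ln(n/2)^{−3}. -/

import Mathlib

open scoped Classical
open Finset

/-- Vertex set of the `n × n` torus. -/
abbrev Vx (n : ℕ) := Fin n × Fin n

/-- Toroidal distance on the `n × n` torus. -/
def tdist (n : ℕ) (u v : Vx n) : ℕ :=
  min ((u.1 : ℤ) - (v.1 : ℤ)).natAbs (n - ((u.1 : ℤ) - (v.1 : ℤ)).natAbs) +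
  min ((u.2 : ℤ) - (v.2 : ℤ)).natAbs (n - ((u.2 : ℤ) - (v.2 : ℤ)).natAbs)

/-- The normalizing factor at vertex `u`. -/
noncomputable def Zfac (n : ℕ) (u : Vx n) : ℝ :=
  (∑ w ∈ univ.filter (fun w => w ≠ u), ((tdist n u w : ℝ) ^ 2)⁻¹)⁻¹

/-- The probability mass of the outcome `c : V → V` (the vector of long-range choices)
under the UTSW product measure: each vertex `u` independently chooses `c u = v ≠ u`
with probability `Z · d(u,v)⁻²`. -/
noncomputable def mass (n : ℕ) (c : Vx n → Vx n) : ℝ :=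
  ∏ u : Vx n, if c u = u then 0 else Zfac n u * ((tdist n u (c u) : ℝ) ^ 2)⁻¹

/-- Probability of an event under the UTSW product measure. -/
noncomputable def Pr (n : ℕ) (E : Set (Vx n → Vx n)) : ℝ :=
  ∑ c : Vx n → Vx n, if c ∈ E then mass n c else 0

/-- `{x, y}` is an edge of the UTSW random graph `G(c)`. -/
def isEdge (n : ℕ) (c : Vx n → Vx n) (x y : Vx n) : Prop :=
  x ≠ y ∧ (tdist n x y = 1 ∨ c x = y ∨ c y = x)

/-- `{x, y}` is an edge of `G(c)` of the given kind: local (`w = false`, distance one)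
or long-range (`w = true`, distance not one). -/
def edgeKind (n : ℕ) (c : Vx n → Vx n) (x y : Vx n) (w : Bool) : Prop :=
  isEdge n c x y ∧ (tdist n x y = 1 ↔ w = false)

/-- There is a four-cycle rooted at `u` in `G(c)` whose edge sequence has the local/long-range
pattern `(p₁, p₂, p₃, p₄)` (`false` = local edge, `true` = long-range edge). -/
def cyclePat (n : ℕ) (c : Vx n → Vx n) (u : Vx n) (p₁ p₂ p₃ p₄ : Bool) : Prop :=
  ∃ a b e : Vx n, a ≠ b ∧ a ≠ e ∧ b ≠ e ∧ a ≠ u ∧ b ≠ u ∧ e ≠ u ∧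
    edgeKind n c u a p₁ ∧ edgeKind n c a b p₂ ∧ edgeKind n c b e p₃ ∧ edgeKind n c e u p₄

/-- `ζ(3) = ∑_{i ≥ 1} i⁻³`. -/
noncomputable def zeta3 : ℝ := ∑' i : ℕ, ((i + 1 : ℝ) ^ 3)⁻¹


/-- Distance of `x` from `0` on the cycle of length `n`. -/
def circNorm (n : ℕ) (x : Fin n) : ℕ := min x.val (n - x.val)

/-- Toroidal distance of `w` from the origin. -/
def torusNorm (n : ℕ) (w : Vx n) : ℕ := circNorm n w.1 + circNorm n w.2

/-- The unnormalized long-range weight `d⁻²` of a displacement (zero at the origin). -/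
noncomputable def weight (n : ℕ) (w : Vx n) : ℝ := ((torusNorm n w : ℝ) ^ 2)⁻¹

/-- Quarter turn of the torus. -/
def rot (n : ℕ) [NeZero n] : Vx n ≃ Vx n where
  toFun w := (-w.2, w.1)
  invFun w := (w.2, -w.1)
  left_inv w := by simp
  right_inv w := by simp

lemma Fin.val_neg_eq_ite {n : ℕ} [NeZero n] (x : Fin n) :
    (-x).val = if x.val = 0 then 0 else n - x.val := by
  simp only [Fin.val_neg, Fin.ext_iff, Fin.val_zero]

lemma circNorm_neg (n : ℕ) [NeZero n] (x : Fin n) : circNorm n (-x) = circNorm n x := by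
  unfold circNorm
  rw [Fin.val_neg]
  have := x.isLt
  split_ifs with h
  · simp [h]
  · omega

lemma circNorm_sub (n : ℕ) [NeZero n] (x y : Fin n) :
    circNorm n (x - y) = min ((x : ℤ) - (y : ℤ)).natAbs (n - ((x : ℤ) - (y : ℤ)).natAbs) := by
  unfold circNorm
  have hx := x.isLt
  have hy := y.isLt
  rcases le_or_gt y x with h | h
  · have h1 := Fin.coe_sub_iff_le.2 h
    have : y.val ≤ x.val := h
    omega
  · have h1 := Fin.coe_sub_iff_lt.2 h
    have : x.val < y.val := h
    omega

lemma tdist_eq (n : ℕ) [NeZero n] (u v : Vx n) : tdist n u v = torusNorm n (u - v) := by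
  simp [tdist, torusNorm, circNorm_sub]

lemma tdist_comm (n : ℕ) (u v : Vx n) : tdist n u v = tdist n v u := by
  unfold tdist
  omega

lemma torusNorm_rot (n : ℕ) [NeZero n] (w : Vx n) : torusNorm n (rot n w) = torusNorm n w := by
  simp [torusNorm, rot, circNorm_neg, add_comm]

lemma weight_rot (n : ℕ) [NeZero n] (w : Vx n) : weight n (rot n w) = weight n w := by
  simp [weight, torusNorm_rot]

lemma weight_nonneg (n : ℕ) (w : Vx n) : 0 ≤ weight n w := by
  unfold weight
  positivity

lemma weight_zero (n : ℕ) [NeZero n] : weight n 0 = 0 := by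
  simp [weight, torusNorm, circNorm]

lemma sum_rotations (n : ℕ) [NeZero n] (h : Vx n → ℝ) :
    ∑ w, (h w + h (rot n w) + h (rot n (rot n w)) + h (rot n (rot n (rot n w)))) =
      4 * ∑ w, h w := by
  have h1 (k : Vx n → ℝ) : ∑ w, k (rot n w) = ∑ w, k w := Equiv.sum_comp (rot n) k
  simp only [sum_add_distrib]
  rw [h1 h, h1 fun w => h (rot n w), h1 h, h1 fun w => h (rot n (rot n w)),
    h1 fun w => h (rot n w), h1 h]
  ring

lemma sum_triangle (N : ℕ) (h : ℕ → ℝ) :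
    ∑ p ∈ (range (N + 1) ×ˢ range (N + 1)).filter (fun p => 1 ≤ p.1 ∧ p.1 + p.2 ≤ N),
      h (p.1 + p.2) = ∑ j ∈ Icc 1 N, (j : ℝ) * h j := by
  have h1 : ∑ j ∈ Icc 1 N, (j : ℝ) * h j = ∑ j ∈ Icc 1 N, ∑ _i ∈ range j, h j := by simp
  rw [h1, Finset.sum_sigma']
  refine Finset.sum_nbij' (fun p => ⟨p.1 + p.2, p.2⟩) (fun q => (q.1 - q.2, q.2)) ?_ ?_ ?_ ?_ ?_
  · rintro ⟨x, y⟩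
    simp
    omega
  · rintro ⟨x, y⟩
    simp
    omega
  · rintro ⟨x, y⟩
    simp
  · rintro ⟨x, y⟩
    simp
    omega
  · simp

/-- The coordinates of a torus vertex as a pair of natural numbers. -/
def coords (n : ℕ) : Vx n ↪ ℕ × ℕ :=
  ⟨fun w => (w.1.val, w.2.val), fun a b h => by
    simp only [Prod.mk.injEq] at h
    exact Prod.ext (Fin.ext h.1) (Fin.ext h.2)⟩

lemma coords_apply (n : ℕ) (w : Vx n) : coords n w = (w.1.val, w.2.val) := rfl

lemma sum_weight_ge (n : ℕ) (hn : 3 ≤ n) [NeZero n] :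
    4 * Real.log ((n : ℝ) / 2) ≤ ∑ w, weight n w := by
  set m := (n - 1) / 2 with hm
  let Q : Vx n → Prop := fun w => 1 ≤ w.1.val ∧ w.1.val + w.2.val ≤ m
  have hdisj (w : Vx n) : (if Q w then weight n w else 0) +
      (if Q (rot n w) then weight n (rot n w) else 0) +
      (if Q (rot n (rot n w)) then weight n (rot n (rot n w)) else 0) +
      (if Q (rot n (rot n (rot n w))) then weight n (rot n (rot n (rot n w))) else 0) ≤
        weight n w := by
    have h0 := weight_nonneg n w
    simp only [weight_rot]
    obtain ⟨x, y⟩ := w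
    have hx := x.isLt
    have hy := y.isLt
    simp only [Q, rot, Equiv.coe_fn_mk, Fin.val_neg_eq_ite, neg_neg]
    split_ifs <;> first | linarith | omega
  have hsum : 4 * ∑ w, (if Q w then weight n w else 0) ≤ ∑ w, weight n w := by
    rw [← sum_rotations]
    exact Finset.sum_le_sum fun w _ => hdisj w
  have hQ : ∑ w, (if Q w then weight n w else 0) = ∑ j ∈ Icc 1 m, (j : ℝ)⁻¹ := by
    have h1 : ∑ j ∈ Icc 1 m, (j : ℝ)⁻¹ = ∑ j ∈ Icc 1 m, (j : ℝ) * ((j : ℝ) ^ 2)⁻¹ := by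
      refine Finset.sum_congr rfl fun j hj => ?_
      have : (j : ℝ) ≠ 0 := by
        have := (Finset.mem_Icc.1 hj).1
        positivity
      field_simp
    rw [h1, ← sum_triangle m fun j => ((j : ℝ) ^ 2)⁻¹, ← Finset.sum_filter]
    have h2 : (range (m + 1) ×ˢ range (m + 1)).filter (fun p => 1 ≤ p.1 ∧ p.1 + p.2 ≤ m) =
        (univ.filter Q).map (coords n) := by
      ext ⟨x, y⟩
      simp only [Q, coords_apply, mem_filter, mem_product, mem_range, mem_map, mem_univ, true_and,
        Prod.mk.injEq]
      constructor
      · rintro ⟨⟨hx, hy⟩, h⟩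
        exact ⟨(⟨x, by omega⟩, ⟨y, by omega⟩), h, rfl, rfl⟩
      · rintro ⟨w, h, rfl, rfl⟩
        omega
    rw [h2, Finset.sum_map]
    refine Finset.sum_congr rfl fun w hw => ?_
    have hw := (Finset.mem_filter.1 hw).2
    simp only [Q] at hw
    have : torusNorm n w = w.1.val + w.2.val := by
      simp only [torusNorm, circNorm]
      omega
    simp [weight, this, coords_apply]
  have hlog : Real.log ((n : ℝ) / 2) ≤ ∑ j ∈ Icc 1 m, (j : ℝ)⁻¹ := by
    have h1 := log_add_one_le_harmonic m
    rw [harmonic_eq_sum_Icc] at h1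
    push_cast at h1
    refine le_trans (Real.log_le_log (by positivity) ?_) h1
    have : n ≤ 2 * (m + 1) := by omega
    have : (n : ℝ) ≤ 2 * (m + 1) := by exact_mod_cast this
    linarith
  linarith

lemma sum_Icc_inv_cube_le (N : ℕ) : ∑ j ∈ Icc 1 N, (j : ℝ) * (((j : ℝ) ^ 2)⁻¹) ^ 2 ≤ zeta3 := by
  have hs : Summable fun i : ℕ => ((i + 1 : ℝ) ^ 3)⁻¹ := by
    have := (summable_nat_add_iff 1).2 (Real.summable_nat_pow_inv.2 (by norm_num : 1 < 3))
    simpa using this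
  refine le_trans (le_of_eq ?_) (hs.sum_le_tsum (range N) fun i _ => by positivity)
  refine Finset.sum_nbij' (fun j => j - 1) (fun i => i + 1) ?_ ?_ ?_ ?_ fun j hj => ?_
  · simp
    omega
  · simp
  · simp
    omega
  · simp
  · have h1 := (Finset.mem_Icc.1 hj).1
    have : (j : ℝ) ≠ 0 := by positivity
    push_cast [Nat.cast_sub h1]
    rw [sub_add_cancel]
    field_simp

lemma sum_weight_sq_le (n : ℕ) [NeZero n] : ∑ w, weight n w ^ 2 ≤ 4 * zeta3 := by
  let Q : Vx n → Prop := fun w => 1 ≤ w.1.val ∧ 2 * w.1.val ≤ n ∧ 2 * w.2.val ≤ n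
  have hcover (w : Vx n) : weight n w ^ 2 ≤ (if Q w then weight n w ^ 2 else 0) +
      (if Q (rot n w) then weight n (rot n w) ^ 2 else 0) +
      (if Q (rot n (rot n w)) then weight n (rot n (rot n w)) ^ 2 else 0) +
      (if Q (rot n (rot n (rot n w))) then weight n (rot n (rot n (rot n w))) ^ 2 else 0) := by
    have h0 := sq_nonneg (weight n w)
    simp only [weight_rot]
    by_cases hw : w = 0
    · subst hw
      simp [weight_zero]
    obtain ⟨x, y⟩ := w
    have hx := x.isLt
    have hy := y.isLt
    have hxy : ¬ (x.val = 0 ∧ y.val = 0) := fun h =>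
      hw (Prod.ext (Fin.ext (by simpa using h.1)) (Fin.ext (by simpa using h.2)))
    simp only [Q, rot, Equiv.coe_fn_mk, Fin.val_neg_eq_ite, neg_neg]
    split_ifs <;> first | linarith | omega
  have hsum : ∑ w, weight n w ^ 2 ≤ 4 * ∑ w, (if Q w then weight n w ^ 2 else 0) := by
    rw [← sum_rotations]
    exact Finset.sum_le_sum fun w _ => hcover w
  have hQ : ∑ w, (if Q w then weight n w ^ 2 else 0) ≤ zeta3 := by
    refine le_trans ?_ (sum_Icc_inv_cube_le n)
    rw [← sum_triangle n fun j => (((j : ℝ) ^ 2)⁻¹) ^ 2, ← Finset.sum_filter]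
    have h2 : (univ.filter Q).map (coords n) ⊆
        (range (n + 1) ×ˢ range (n + 1)).filter (fun p => 1 ≤ p.1 ∧ p.1 + p.2 ≤ n) := by
      rintro ⟨x, y⟩
      simp only [Q, coords_apply, mem_filter, mem_product, mem_range, mem_map, mem_univ, true_and,
        Prod.mk.injEq]
      rintro ⟨w, h, rfl, rfl⟩
      omega
    refine le_trans (le_of_eq ?_)
      (Finset.sum_le_sum_of_subset_of_nonneg h2 fun p _ _ => by positivity)
    rw [Finset.sum_map]
    refine Finset.sum_congr rfl fun w hw => ?_
    have hw := (Finset.mem_filter.1 hw).2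
    simp only [Q] at hw
    have : torusNorm n w = w.1.val + w.2.val := by
      simp only [torusNorm, circNorm]
      omega
    simp [weight, this, coords_apply]
  linarith

lemma card_neighbors_le (n : ℕ) (hn : 3 ≤ n) [NeZero n] :
    (univ.filter fun w : Vx n => torusNorm n w = 1).card ≤ 4 := by
  refine le_trans (Finset.card_le_card ?_) (Finset.card_le_four (a := ((⟨1, by omega⟩, 0) : Vx n))
    (b := (0, ⟨1, by omega⟩)) (c := (⟨n - 1, by omega⟩, 0)) (d := (0, ⟨n - 1, by omega⟩)))
  rintro ⟨x, y⟩ h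
  have hx := x.isLt
  have hy := y.isLt
  replace h := (Finset.mem_filter.1 h).2
  simp only [torusNorm, circNorm] at h
  simp only [mem_insert, mem_singleton, Prod.mk.injEq, Fin.ext_iff, Fin.val_zero]
  omega

lemma weight_sub_comm (n : ℕ) [NeZero n] (x y : Vx n) : weight n (x - y) = weight n (y - x) := by
  rw [weight, weight, ← tdist_eq, ← tdist_eq, tdist_comm]

lemma sum_sub_left {G : Type*} [AddGroup G] [Fintype G] (h : G → ℝ) (u : G) :
    ∑ w, h (u - w) = ∑ w, h w :=
  Equiv.sum_comp (Equiv.subLeft u) h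

lemma sum_sub_right {G : Type*} [AddGroup G] [Fintype G] (h : G → ℝ) (u : G) :
    ∑ w, h (w - u) = ∑ w, h w :=
  Equiv.sum_comp (Equiv.subRight u) h

lemma Zfac_eq (n : ℕ) [NeZero n] (u : Vx n) : Zfac n u = (∑ w, weight n w)⁻¹ := by
  rw [Zfac, ← sum_sub_left (weight n) u, Finset.sum_filter]
  congr 1
  refine Finset.sum_congr rfl fun w _ => ?_
  split_ifs with h
  · simp [weight, tdist_eq]
  · simp only [not_not] at h
    simp [h, weight_zero]

lemma mass_eq (n : ℕ) [NeZero n] (c : Vx n → Vx n) :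
    mass n c = ∏ u, (∑ w, weight n w)⁻¹ * weight n (u - c u) := by
  unfold mass
  refine Finset.prod_congr rfl fun u _ => ?_
  split_ifs with h
  · simp [h, weight_zero]
  · rw [Zfac_eq, tdist_eq, weight]

lemma mass_nonneg (n : ℕ) [NeZero n] (c : Vx n → Vx n) : 0 ≤ mass n c := by
  rw [mass_eq]
  exact Finset.prod_nonneg fun u _ =>
    mul_nonneg (inv_nonneg.2 (Finset.sum_nonneg fun w _ => weight_nonneg n w)) (weight_nonneg n _)

/-- Under a product of probability vectors, the probability that finitely many distinct
coordinates take prescribed values is the product of the individual probabilities. -/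
lemma sum_cylinder {V ι : Type*} [Fintype V] [DecidableEq V] [Fintype ι] (p : V → V → ℝ)
    (hp : ∀ u, ∑ v, p u v = 1) (x y : ι → V) (hx : Function.Injective x) :
    ∑ c : V → V, (if ∀ i, c (x i) = y i then ∏ u, p u (c u) else 0) = ∏ i, p (x i) (y i) := by
  let q : V → V → ℝ := fun u v => if ∀ i, x i = u → v = y i then p u v else 0
  have h1 (c : V → V) :
      (if ∀ i, c (x i) = y i then ∏ u, p u (c u) else 0) = ∏ u, q u (c u) := by
    simp only [q, Finset.prod_ite_zero]
    have hiff : (∀ i, c (x i) = y i) ↔ ∀ u ∈ univ, ∀ i, x i = u → c u = y i :=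
      ⟨by rintro h u - i rfl; exact h i, fun h i => h (x i) (mem_univ _) i rfl⟩
    by_cases h : ∀ i, c (x i) = y i
    · rw [if_pos h, if_pos (hiff.1 h)]
    · rw [if_neg h, if_neg (mt hiff.2 h)]
  have h2 : ∑ c : V → V, ∏ u, q u (c u) = ∏ u, ∑ v, q u v := by
    rw [Finset.prod_univ_sum, Fintype.piFinset_univ]
  have h3 : ∏ i, p (x i) (y i) = ∏ u ∈ univ.image x, ∑ v, q u v := by
    rw [Finset.prod_image fun i _ j _ h => hx h]
    refine Finset.prod_congr rfl fun i _ => ?_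
    have (v : V) : q (x i) v = if v = y i then p (x i) v else 0 := by
      refine if_congr ⟨fun h => h i rfl, ?_⟩ rfl rfl
      rintro h j hj
      rw [hx hj, h]
    simp [this]
  rw [Finset.sum_congr rfl fun c _ => h1 c, h2, h3]
  refine (Finset.prod_subset (subset_univ _) fun u _ hu => ?_).symm
  rw [← hp u]
  refine Finset.sum_congr rfl fun v _ => if_pos ?_
  rintro i rfl
  exact absurd (mem_image_of_mem x (mem_univ i)) hu

lemma sum_mass_three (n : ℕ) [NeZero n] (hS : ∑ w, weight n w ≠ 0)
    {x₁ x₂ x₃ : Vx n} (y₁ y₂ y₃ : Vx n) (h₁₂ : x₁ ≠ x₂) (h₁₃ : x₁ ≠ x₃) (h₂₃ : x₂ ≠ x₃) :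
    ∑ c : Vx n → Vx n, (if c x₁ = y₁ ∧ c x₂ = y₂ ∧ c x₃ = y₃ then mass n c else 0) =
      (∑ w, weight n w)⁻¹ ^ 3 *
        (weight n (x₁ - y₁) * weight n (x₂ - y₂) * weight n (x₃ - y₃)) := by
  have hp (u : Vx n) : ∑ v, (∑ w, weight n w)⁻¹ * weight n (u - v) = 1 := by
    rw [← Finset.mul_sum, sum_sub_left (weight n), inv_mul_cancel₀ hS]
  have hinj : Function.Injective ![x₁, x₂, x₃] := by
    intro i j
    fin_cases i <;> fin_cases j <;> simp [h₁₂, h₁₃, h₂₃, h₁₂.symm, h₁₃.symm, h₂₃.symm]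
  have h := sum_cylinder _ hp ![x₁, x₂, x₃] ![y₁, y₂, y₃] hinj
  simp only [Fin.forall_fin_succ, Fin.prod_univ_three] at h
  simp only [mass_eq]
  convert h using 1
  · refine Finset.sum_congr rfl fun c _ => if_congr ?_ rfl rfl
    simp
  · simp
    ring

lemma sum_neighbors_le (n : ℕ) (hn : 3 ≤ n) [NeZero n] (u e : Vx n) :
    ∑ a, ∑ b, (if torusNorm n (a - b) = 1 then weight n (u - a) * weight n (b - e) else 0) ≤
      4 * ∑ w, weight n w ^ 2 := by
  let N : Vx n → ℝ := fun w => if torusNorm n w = 1 then 1 else 0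
  have hN : ∑ w, N w ≤ 4 := by
    simp only [N, Finset.sum_boole]
    exact_mod_cast card_neighbors_le n hn
  have hN1 (a : Vx n) : ∑ b, N (a - b) ≤ 4 := by
    rwa [sum_sub_left N]
  have hN2 (b : Vx n) : ∑ a, N (a - b) ≤ 4 := by
    rwa [sum_sub_right N]
  have hterm (a b : Vx n) :
      (if torusNorm n (a - b) = 1 then weight n (u - a) * weight n (b - e) else 0) ≤
        weight n (u - a) ^ 2 / 2 * N (a - b) + weight n (b - e) ^ 2 / 2 * N (a - b) := by
    simp only [N]
    split_ifs
    · nlinarith [sq_nonneg (weight n (u - a) - weight n (b - e))]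
    · simp
  have hleft : ∑ a, ∑ b, weight n (u - a) ^ 2 / 2 * N (a - b) ≤ 2 * ∑ w, weight n w ^ 2 := by
    rw [← sum_sub_left (fun w => weight n w ^ 2) u, Finset.mul_sum]
    refine Finset.sum_le_sum fun a _ => ?_
    rw [← Finset.mul_sum]
    nlinarith [hN1 a, sq_nonneg (weight n (u - a))]
  have hright : ∑ a, ∑ b, weight n (b - e) ^ 2 / 2 * N (a - b) ≤ 2 * ∑ w, weight n w ^ 2 := by
    rw [Finset.sum_comm, ← sum_sub_right (fun w => weight n w ^ 2) e,
      Finset.mul_sum]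
    refine Finset.sum_le_sum fun b _ => ?_
    rw [← Finset.mul_sum]
    nlinarith [hN2 b, sq_nonneg (weight n (b - e))]
  refine le_trans (Finset.sum_le_sum fun a _ => Finset.sum_le_sum fun b _ => hterm a b) ?_
  simp only [Finset.sum_add_distrib]
  linarith

lemma edgeKind_comm {n : ℕ} {c : Vx n → Vx n} {x y : Vx n} {w : Bool}
    (h : edgeKind n c x y w) : edgeKind n c y x w := by
  obtain ⟨⟨hne, h⟩, hw⟩ := h
  rw [tdist_comm] at h hw
  exact ⟨⟨hne.symm, by tauto⟩, hw⟩

lemma cyclePat_reverse {n : ℕ} {c : Vx n → Vx n} {u : Vx n} {p₁ p₂ p₃ p₄ : Bool}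
    (h : cyclePat n c u p₁ p₂ p₃ p₄) : cyclePat n c u p₄ p₃ p₂ p₁ := by
  obtain ⟨a, b, e, hab, hae, hbe, hau, hbu, heu, h₁, h₂, h₃, h₄⟩ := h
  exact ⟨e, b, a, hbe.symm, hae.symm, hab.symm, heu, hbu, hau, edgeKind_comm h₄, edgeKind_comm h₃,
    edgeKind_comm h₂, edgeKind_comm h₁⟩

lemma edgeKind_true {n : ℕ} {c : Vx n → Vx n} {x y : Vx n} (h : edgeKind n c x y true) :
    c x = y ∨ c y = x := by
  obtain ⟨⟨-, h⟩, hw⟩ := h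
  simp only [Bool.true_eq_false, iff_false] at hw
  tauto

lemma Pr_cyclePat_le (n : ℕ) (hn : 3 ≤ n) [NeZero n] (hS : 0 < ∑ w, weight n w) (u : Vx n) :
    Pr n {c | cyclePat n c u true false true true ∨ cyclePat n c u true true false true} ≤
      16 * (∑ w, weight n w ^ 2) * (∑ w, weight n w)⁻¹ ^ 2 := by
  set S := ∑ w, weight n w with hSdef
  clear_value S
  let D : Vx n → Vx n → Vx n → Prop := fun a b e =>
    a ≠ b ∧ a ≠ e ∧ b ≠ e ∧ a ≠ u ∧ b ≠ u ∧ e ≠ u ∧ torusNorm n (a - b) = 1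
  let I : (Vx n → Vx n) → Vx n → Vx n → Vx n → Vx n → Vx n → Vx n → ℝ :=
    fun c x₁ y₁ x₂ y₂ x₃ y₃ => if c x₁ = y₁ ∧ c x₂ = y₂ ∧ c x₃ = y₃ then mass n c else 0
  let J : (Vx n → Vx n) → Vx n → Vx n → Vx n → ℝ := fun c a b e =>
    I c u a e u b e + I c a u e u b e + I c a u u e b e + I c a u u e e b
  have hI0 (c x₁ y₁ x₂ y₂ x₃ y₃) : 0 ≤ I c x₁ y₁ x₂ y₂ x₃ y₃ := by
    simp only [I]
    split_ifs
    exacts [mass_nonneg n c, le_rfl]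
  have hJ0 (c a b e) : 0 ≤ if D a b e then J c a b e else 0 := by
    split_ifs
    · exact add_nonneg (add_nonneg (add_nonneg (hI0 ..) (hI0 ..)) (hI0 ..)) (hI0 ..)
    · exact le_rfl
  have hunion (c : Vx n → Vx n) :
      (if c ∈ {c | cyclePat n c u true false true true ∨ cyclePat n c u true true false true}
        then mass n c else 0) ≤ ∑ e, ∑ a, ∑ b, if D a b e then J c a b e else 0 := by
    split_ifs with hc
    · obtain ⟨a, b, e, hab, hae, hbe, hau, hbu, heu, h₁, h₂, h₃, h₄⟩ :
          cyclePat n c u true false true true := hc.elim id cyclePat_reverse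
      have hD : D a b e := ⟨hab, hae, hbe, hau, hbu, heu, by
        rw [← tdist_eq]
        exact h₂.2.2 rfl⟩
      calc mass n c ≤ J c a b e := by
            have k₁ := hI0 c u a e u b e
            have k₂ := hI0 c a u e u b e
            have k₃ := hI0 c a u u e b e
            have k₄ := hI0 c a u u e e b
            have hcases : (c u = a ∧ c e = u ∧ c b = e) ∨ (c a = u ∧ c e = u ∧ c b = e) ∨
                (c a = u ∧ c u = e ∧ c b = e) ∨ (c a = u ∧ c u = e ∧ c e = b) := by
              have := edgeKind_true h₁
              have := edgeKind_true h₃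
              have := edgeKind_true h₄
              grind
            simp only [J]
            rcases hcases with h | h | h | h
            · have : I c u a e u b e = mass n c := if_pos h
              linarith
            · have : I c a u e u b e = mass n c := if_pos h
              linarith
            · have : I c a u u e b e = mass n c := if_pos h
              linarith
            · have : I c a u u e e b = mass n c := if_pos h
              linarith
        _ = if D a b e then J c a b e else 0 := (if_pos hD).symm
        _ ≤ ∑ b, if D a b e then J c a b e else 0 :=
            Finset.single_le_sum (f := fun b => if D a b e then J c a b e else 0)
              (fun b _ => hJ0 c a b e) (mem_univ b)
        _ ≤ ∑ a, ∑ b, if D a b e then J c a b e else 0 :=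
            Finset.single_le_sum (f := fun a => ∑ b, if D a b e then J c a b e else 0)
              (fun a _ => Finset.sum_nonneg fun b _ => hJ0 c a b e) (mem_univ a)
        _ ≤ _ :=
            Finset.single_le_sum (f := fun e => ∑ a, ∑ b, if D a b e then J c a b e else 0)
              (fun e _ => Finset.sum_nonneg fun a _ => Finset.sum_nonneg fun b _ => hJ0 c a b e)
              (mem_univ e)
    · exact Finset.sum_nonneg fun e _ => Finset.sum_nonneg fun a _ =>
        Finset.sum_nonneg fun b _ => hJ0 c a b e
  have hterm (a b e : Vx n) : (∑ c, if D a b e then J c a b e else 0) ≤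
      4 * S⁻¹ ^ 3 * (weight n (e - u) *
        if torusNorm n (a - b) = 1 then weight n (u - a) * weight n (b - e) else 0) := by
    by_cases hD : D a b e
    · obtain ⟨hab, hae, hbe, hau, hbu, heu, h1⟩ := id hD
      simp only [hD, if_true, J, I, Finset.sum_add_distrib, h1]
      rw [sum_mass_three n (hSdef ▸ hS.ne') _ _ _ heu.symm hbu.symm hbe.symm,
        sum_mass_three n (hSdef ▸ hS.ne') _ _ _ hae hab hbe.symm,
        sum_mass_three n (hSdef ▸ hS.ne') _ _ _ hau hab hbu.symm,
        sum_mass_three n (hSdef ▸ hS.ne') _ _ _ hau hae heu.symm,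
        weight_sub_comm n a u, weight_sub_comm n u e, weight_sub_comm n e b, ← hSdef]
      exact le_of_eq (by ring)
    · simp only [hD, if_false, Finset.sum_const_zero]
      have h1 := weight_nonneg n (e - u)
      have h2 := weight_nonneg n (u - a)
      have h3 := weight_nonneg n (b - e)
      refine mul_nonneg (mul_nonneg zero_le_four (pow_nonneg (inv_nonneg.2 hS.le) 3))
        (mul_nonneg h1 ?_)
      split_ifs
      exacts [mul_nonneg h2 h3, le_rfl]
  have hswap (F : (Vx n → Vx n) → Vx n → Vx n → Vx n → ℝ) :
      ∑ c, ∑ e, ∑ a, ∑ b, F c e a b = ∑ e, ∑ a, ∑ b, ∑ c, F c e a b := by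
    rw [Finset.sum_comm]
    refine Finset.sum_congr rfl fun e _ => ?_
    rw [Finset.sum_comm]
    refine Finset.sum_congr rfl fun a _ => ?_
    rw [Finset.sum_comm]
  calc Pr n {c | cyclePat n c u true false true true ∨ cyclePat n c u true true false true}
      ≤ ∑ c, ∑ e, ∑ a, ∑ b, (if D a b e then J c a b e else 0) := by
        refine Finset.sum_le_sum fun c _ => le_trans (le_of_eq ?_) (hunion c)
        congr
    _ = ∑ e, ∑ a, ∑ b, ∑ c, (if D a b e then J c a b e else 0) :=
        hswap fun c e a b => if D a b e then J c a b e else 0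
    _ ≤ ∑ e, ∑ a, ∑ b, 4 * S⁻¹ ^ 3 * (weight n (e - u) *
          if torusNorm n (a - b) = 1 then weight n (u - a) * weight n (b - e) else 0) :=
        Finset.sum_le_sum fun e _ => Finset.sum_le_sum fun a _ => Finset.sum_le_sum fun b _ =>
          hterm a b e
    _ = 4 * S⁻¹ ^ 3 * ∑ e, weight n (e - u) * ∑ a, ∑ b,
          (if torusNorm n (a - b) = 1 then weight n (u - a) * weight n (b - e) else 0) := by
        simp only [Finset.mul_sum]
    _ ≤ 4 * S⁻¹ ^ 3 * ∑ e, weight n (e - u) * (4 * ∑ w, weight n w ^ 2) := by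
        gcongr with e
        · exact weight_nonneg n _
        · exact sum_neighbors_le n hn u e
    _ = 16 * (∑ w, weight n w ^ 2) * S⁻¹ ^ 2 := by
        rw [← Finset.sum_mul, sum_sub_right (weight n), ← hSdef]
        field_simp
        ring

/-- Probability bound for the event `E8ᵤ`. -/
theorem prob_E8 :
    ∀ n : ℕ, 3 ≤ n → ∀ u : Vx n,
      Pr n {c | cyclePat n c u true false true true ∨ cyclePat n c u true true false true} <
        (12 * zeta3 + 4) * (Real.log (n : ℝ) + 1) * (Real.log ((n : ℝ) / 2) ^ 3)⁻¹ := by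
  intro n hn u
  have : NeZero n := ⟨by omega⟩
  have hn' : (3 : ℝ) ≤ n := by exact_mod_cast hn
  have hL : 0 < Real.log ((n : ℝ) / 2) := Real.log_pos (by linarith)
  have hLn : Real.log ((n : ℝ) / 2) ≤ Real.log n := Real.log_le_log (by positivity) (by linarith)
  have hS := sum_weight_ge n hn
  have hS0 : 0 < ∑ w, weight n w := by linarith
  have hz : 0 ≤ zeta3 := tsum_nonneg fun i => by positivity
  generalize Real.log ((n : ℝ) / 2) = L at *
  calc _ ≤ 16 * (∑ w, weight n w ^ 2) * (∑ w, weight n w)⁻¹ ^ 2 := Pr_cyclePat_le n hn hS0 u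
    _ ≤ 16 * (4 * zeta3) * (4 * L)⁻¹ ^ 2 := by
        gcongr
        exact sum_weight_sq_le n
    _ = 4 * zeta3 * L * (L ^ 3)⁻¹ := by
        field_simp
        ring
    _ < (12 * zeta3 + 4) * (Real.log n + 1) * (L ^ 3)⁻¹ := by
        gcongr ?_ * _
        nlinarith [mul_nonneg hz (sub_nonneg.2 hLn), mul_nonneg hz hL.le]
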